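/- arXiv:1803.03998 — 7 statements merged into one kernel-verified Lean document; each statement's English description precedes it below -/
import Mathlib

section
/- Every arc-colored acyclic digraph has a kernel by rainbow paths. -/
/-- `l` is a (simple directed) rainbow path from `u` to `v` in the digraph with
arc relation `A` and arc-coloring `c`: consecutive vertices are joined by arcs,
vertices are pairwise distinct, and the colors of the arcs are pairwise distinct. -/
def IsRainbowPath {V C : Type*} (A : V → V → Prop) (c : V → V → C)
    (u v : V) (l : List V) : Prop :=
  l.head? = some u ∧ l.getLast? = some v ∧ l.Nodup ∧ l.Chain' A ∧
    ((l.zip l.tail).map fun p => c p.1 p.2).Nodup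

/-- There is a rainbow path from `u` to `v`. -/
def RainbowReach {V C : Type*} (A : V → V → Prop) (c : V → V → C) (u v : V) : Prop :=
  ∃ l : List V, IsRainbowPath A c u v l

/-- `S` is a kernel by rainbow paths of the arc-colored digraph `(A, c)`. -/
def IsRainbowKernel {V C : Type*} (A : V → V → Prop) (c : V → V → C) (S : Set V) : Prop :=
  (∀ u ∈ S, ∀ v ∈ S, u ≠ v → ¬ RainbowReach A c u v) ∧
    ∀ v ∉ S, ∃ s ∈ S, RainbowReach A c v s

/-- `A` is a tournament: no loops, and between any two distinct vertices there is
exactly one arc. -/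
def IsTournament {V : Type*} (A : V → V → Prop) : Prop :=
  (∀ v, ¬ A v v) ∧ ∀ u v : V, u ≠ v → (A u v ↔ ¬ A v u)

/-- `S` is a kernel of the digraph `A`. -/
def IsKernel {V : Type*} (A : V → V → Prop) (S : Set V) : Prop :=
  (∀ u ∈ S, ∀ v ∈ S, u ≠ v → ¬ A u v) ∧ ∀ v ∉ S, ∃ s ∈ S, A v s

/-- The subdigraph induced on `U` is strongly connected. -/
def StronglyConnectedOn {V : Type*} (A : V → V → Prop) (U : Finset V) : Prop :=
  ∀ a ∈ U, ∀ b ∈ U, Relation.ReflTransGen (fun p q => p ∈ U ∧ q ∈ U ∧ A p q) a b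

/-- The set of colors used on the arcs of the subtournament induced on `U`. -/
def colorsOn {V C : Type*} (A : V → V → Prop) (c : V → V → C) (U : Finset V) : Set C :=
  {x | ∃ a ∈ U, ∃ b ∈ U, A a b ∧ c a b = x}

/-- A relation whose converse is well-founded has a kernel. -/
theorem exists_isKernel_of_wellFounded {V : Type*} (R : V → V → Prop)
    (hR : WellFounded (flip R)) : ∃ S : Set V, IsKernel R S := by
  let S : Set V := hR.fix (C := fun _ => Prop) fun v ih => ∀ w (h : R v w), ¬ ih w h
  have hS (v : V) : v ∈ S ↔ ∀ w, R v w → w ∉ S := by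
    change hR.fix (C := fun _ => Prop) _ v ↔ _
    rw [hR.fix_eq]
    rfl
  refine ⟨S, fun u hu v hv _ h => (hS u).1 hu v h hv, fun v hv => ?_⟩
  rw [hS] at hv
  push Not at hv
  obtain ⟨s, hvs, hs⟩ := hv
  exact ⟨s, hs, hvs⟩

theorem List.IsChain.reflTransGen_head_getLast {V : Type*} {A : V → V → Prop} {l : List V}
    (hl : l.IsChain A) {u v : V} (hu : l.head? = some u) (hv : l.getLast? = some v) :
    Relation.ReflTransGen A u v := by
  induction l generalizing u with
  | nil => simp at hu
  | cons a l ih =>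
    obtain rfl : a = u := by simpa using hu
    cases l with
    | nil =>
      obtain rfl : a = v := by simpa using hv
      exact .refl
    | cons b l =>
      rw [List.isChain_cons_cons] at hl
      exact .head hl.1 (ih hl.2 rfl (by simpa [List.getLast?_cons_cons] using hv))

theorem RainbowReach.reflTransGen {V C : Type*} {A : V → V → Prop} {c : V → V → C} {u v : V}
    (h : RainbowReach A c u v) : Relation.ReflTransGen A u v := by
  obtain ⟨l, hu, hv, -, hl, -⟩ := h
  exact List.IsChain.reflTransGen_head_getLast hl hu hv

/-- Every arc-colored acyclic digraph has a kernel by rainbow paths. -/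
theorem rainbow_kernel_of_acyclic {V C : Type*} [Fintype V]
    (A : V → V → Prop) (c : V → V → C)
    (hacyclic : ∀ v : V, ¬ Relation.TransGen A v v) :
    ∃ S : Set V, IsRainbowKernel A c S := by
  have : IsTrans V (flip (Relation.TransGen A)) := ⟨fun _ _ _ h₁ h₂ => h₂.trans h₁⟩
  have : Std.Irrefl (flip (Relation.TransGen A)) := ⟨hacyclic⟩
  have hwf : WellFounded (flip fun u v => u ≠ v ∧ RainbowReach A c u v) :=
    Subrelation.wf (r := flip (Relation.TransGen A))
      (fun {_ _} h => (Relation.reflTransGen_iff_eq_or_transGen.1 h.2.reflTransGen).resolve_left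
        h.1.symm)
      (Finite.wellFounded_of_trans_of_irrefl _)
  obtain ⟨S, hindep, habs⟩ := exists_isKernel_of_wellFounded _ hwf
  refine ⟨S, fun u hu v hv huv h => hindep u hu v hv huv ⟨huv, h⟩, fun v hv => ?_⟩
  obtain ⟨s, hs, -, h⟩ := habs v hv
  exact ⟨s, hs, h⟩
end

section
/- Let T be an arc-colored tournament. If every strongly connected k-vertex subtournament of T is colored with at least k−1 colors, for every k with 3 ≤ k ≤ |V(T)|, then T has a kernel by rainbow paths. -/
/-- There is a rainbow path from `u` to `w` with all vertices in `W` and all colors in `K`. -/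
inductive RainbowPathIn {V C : Type*} (A : V → V → Prop) (c : V → V → C) :
    Set V → Set C → V → V → Prop
  | refl {W : Set V} {K : Set C} {u : V} (hu : u ∈ W) : RainbowPathIn A c W K u u
  | cons {W W' : Set V} {K K' : Set C} {u v w : V} (huv : A u v)
      (h : RainbowPathIn A c W K v w) (hu : u ∉ W) (hc : c u v ∉ K)
      (hW : insert u W ⊆ W') (hK : insert (c u v) K ⊆ K') : RainbowPathIn A c W' K' u w

namespace RainbowPathIn

variable {V C : Type*} {A : V → V → Prop} {c : V → V → C} {W W' : Set V} {K K' : Set C}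
  {u v w : V}

theorem mono (h : RainbowPathIn A c W K u w) (hW : W ⊆ W') (hK : K ⊆ K') :
    RainbowPathIn A c W' K' u w := by
  cases h with
  | refl hu => exact .refl (hW hu)
  | cons huv h hu hc hW₁ hK₁ => exact .cons huv h hu hc (hW₁.trans hW) (hK₁.trans hK)

theorem push (huv : A u v) (h : RainbowPathIn A c W K v w) (hu : u ∉ W) (hc : c u v ∉ K) :
    RainbowPathIn A c (insert u W) (insert (c u v) K) u w :=
  .cons huv h hu hc subset_rfl subset_rfl

theorem right_mem (h : RainbowPathIn A c W K u w) : w ∈ W := by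
  induction h with
  | refl hu => exact hu
  | cons _ _ _ _ hW _ ih => exact hW (Or.inr ih)

theorem trans (h : RainbowPathIn A c W K u v) (h' : RainbowPathIn A c W' K' v w)
    (hW : W ∩ W' ⊆ {v}) (hK : Disjoint K K') :
    RainbowPathIn A c (W ∪ W') (K ∪ K') u w := by
  induction h with
  | refl hu => exact h'.mono Set.subset_union_right Set.subset_union_right
  | @cons W₁ W₂ K₁ K₂ a b d hab h₁ ha hc hW₁ hK₁ ih =>
    have ih' := ih h' (fun z hz => hW ⟨hW₁ (Or.inr hz.1), hz.2⟩)
      (hK.mono_left fun z hz => hK₁ (Or.inr hz))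
    refine .cons hab ih' ?_ ?_ ?_ ?_
    · rintro (h | h)
      · exact ha h
      · have : a = d := hW ⟨hW₁ (Or.inl rfl), h⟩
        exact ha (this ▸ h₁.right_mem)
    · rintro (h | h)
      · exact hc h
      · exact Set.disjoint_left.mp hK (hK₁ (Or.inl rfl)) h
    · rintro z (rfl | h | h)
      exacts [Or.inl (hW₁ (Or.inl rfl)), Or.inl (hW₁ (Or.inr h)), Or.inr h]
    · rintro z (rfl | h | h)
      exacts [Or.inl (hK₁ (Or.inl rfl)), Or.inl (hK₁ (Or.inr h)), Or.inr h]

theorem snoc (h : RainbowPathIn A c W K u v) (hvw : A v w) (hw : w ∉ W) (hc : c v w ∉ K) :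
    RainbowPathIn A c (insert w W) (insert (c v w) K) u w := by
  have hv : v ≠ w := fun e => hw (e ▸ h.right_mem)
  have h' : RainbowPathIn A c {v, w} {c v w} v w :=
    .cons (W := {w}) (K := ∅) hvw (.refl rfl) (by simpa using hv) (by simp) subset_rfl (by simp)
  refine (h.trans h' ?_ (by simpa using hc)).mono ?_ ?_
  · rintro z ⟨hz, rfl | rfl⟩
    exacts [rfl, absurd hz hw]
  · rintro z (hz | rfl | rfl)
    exacts [Or.inr hz, Or.inr h.right_mem, Or.inl rfl]
  · rintro z (hz | rfl)
    exacts [Or.inr hz, Or.inl rfl]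

theorem rainbowReach (h : RainbowPathIn A c W K u w) : RainbowReach A c u w := by
  suffices ∃ l, IsRainbowPath A c u w l ∧ (∀ x ∈ l, x ∈ W) ∧
      ∀ x ∈ (l.zip l.tail).map fun p => c p.1 p.2, x ∈ K from this.imp fun _ h => h.1
  induction h with
  | @refl W K u hu => exact ⟨[u], ⟨rfl, rfl, by simp, List.isChain_singleton u, by simp⟩, by simpa using hu, by simp⟩
  | @cons W W' K K' u v w huv h hu hc hW hK ih =>
    obtain ⟨l, ⟨h₁, h₂, h₃, h₄, h₅⟩, hlW, hlK⟩ := ih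
    cases l with
    | nil => simp at h₁
    | cons a l =>
      obtain rfl : a = v := by simpa using h₁
      have hz : (((u :: a :: l).zip (u :: a :: l).tail).map fun p => c p.1 p.2) =
          c u a :: (((a :: l).zip (a :: l).tail).map fun p => c p.1 p.2) := by simp
      refine ⟨u :: a :: l, ⟨rfl, by simpa using h₂, ?_, ?_, ?_⟩, ?_, ?_⟩
      · exact List.nodup_cons.mpr ⟨fun h => hu (hlW _ h), h₃⟩
      · exact List.isChain_cons_cons.mpr ⟨huv, h₄⟩
      · rw [hz]
        exact List.nodup_cons.mpr ⟨fun h => hc (hlK _ h), h₅⟩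
      · intro x hx
        rcases List.mem_cons.mp hx with rfl | hx
        exacts [hW (Or.inl rfl), hW (Or.inr (hlW _ hx))]
      · intro x hx
        rw [hz] at hx
        rcases List.mem_cons.mp hx with rfl | hx
        exacts [hK (Or.inl rfl), hK (Or.inr (hlK _ hx))]

theorem left_mem (h : RainbowPathIn A c W K u w) : u ∈ W := by
  cases h with
  | refl hu => exact hu
  | cons _ _ _ _ hW _ => exact hW (Or.inl rfl)

theorem reflTransGen (h : RainbowPathIn A c W K u w) :
    Relation.ReflTransGen (fun p q => p ∈ W ∧ q ∈ W ∧ A p q) u w := by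
  induction h with
  | refl _ => exact .refl
  | cons huv h _ _ hW _ ih =>
    exact .head ⟨hW (Or.inl rfl), hW (Or.inr h.left_mem), huv⟩
      (Relation.ReflTransGen.mono
        (fun p q h => ⟨hW (Or.inr h.1), hW (Or.inr h.2.1), h.2.2⟩) _ _ ih)

end RainbowPathIn

theorem IsTournament.asymm {V : Type*} {A : V → V → Prop} (hT : IsTournament A) {u v : V}
    (h : A u v) : ¬ A v u :=
  (hT.2 u v fun e => hT.1 v (e ▸ h)).mp h

open Classical in
/-- Suppose the vertices of `Z` can all reach `z ∈ Z` inside `Z`, and every vertex of `S` is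
dominated by `z` and dominates `Z \ {z}`. If the arcs on `Z ∪ S` only have colors in `Ψ`, then
`Ψ` is large. -/
theorem card_add_card_le_of_colors_subset {V C : Type*} {A : V → V → Prop} {c : V → V → C}
    (hcol : ∀ U : Finset V, 3 ≤ U.card → StronglyConnectedOn A U →
      U.card - 1 ≤ (colorsOn A c U).ncard)
    {Z S : Finset V} {Φ : Set C} {Ψ : Finset C} {z : V} (hZ : 2 ≤ Z.card)
    (hZS : Disjoint Z S) (hS : S.Nonempty)
    (hreach : ∀ w ∈ Z, RainbowPathIn A c Z Φ w z)
    (hzS : ∀ s ∈ S, A z s) (hSZ : ∀ s ∈ S, ∀ w ∈ Z, w ≠ z → A s w)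
    (hΨ : colorsOn A c (Z ∪ S) ⊆ Ψ) : Z.card + S.card ≤ Ψ.card + 1 := by
  obtain ⟨s₀, hs₀⟩ := hS
  obtain ⟨w₀, hw₀, hwz⟩ := Finset.exists_mem_ne (by omega : 1 < Z.card) z
  have hz : z ∈ Z := (hreach w₀ hw₀).right_mem
  have hcard := Finset.card_union_of_disjoint hZS
  have hS1 : 0 < S.card := Finset.card_pos.mpr ⟨s₀, hs₀⟩
  have toz : ∀ a ∈ Z ∪ S,
      Relation.ReflTransGen (fun p q => p ∈ Z ∪ S ∧ q ∈ Z ∪ S ∧ A p q) a z := by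
    have aux : ∀ a ∈ Z,
        Relation.ReflTransGen (fun p q => p ∈ Z ∪ S ∧ q ∈ Z ∪ S ∧ A p q) a z := fun a ha =>
      Relation.ReflTransGen.mono (fun p q h =>
        ⟨Finset.mem_union_left _ h.1, Finset.mem_union_left _ h.2.1, h.2.2⟩) _ _
        (hreach a ha).reflTransGen
    intro a ha
    rcases Finset.mem_union.mp ha with h | h
    · exact aux a h
    · exact .head ⟨ha, Finset.mem_union_left _ hw₀, hSZ a h w₀ hw₀ hwz⟩ (aux w₀ hw₀)
  have fromz : ∀ b ∈ Z ∪ S,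
      Relation.ReflTransGen (fun p q => p ∈ Z ∪ S ∧ q ∈ Z ∪ S ∧ A p q) z b := by
    have hzs : ∀ s ∈ S, z ∈ Z ∪ S ∧ s ∈ Z ∪ S ∧ A z s := fun s hs =>
      ⟨Finset.mem_union_left _ hz, Finset.mem_union_right _ hs, hzS s hs⟩
    intro b hb
    rcases Finset.mem_union.mp hb with h | h
    · by_cases hbz : b = z
      · subst hbz; exact .refl
      · exact .head (hzs s₀ hs₀)
          (.single ⟨Finset.mem_union_right _ hs₀, hb, hSZ s₀ hs₀ b h hbz⟩)
    · exact .single (hzs b h)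
  have h := hcol (Z ∪ S) (by omega) fun a ha b hb => (toz a ha).trans (fromz b hb)
  have h' := Set.ncard_le_ncard hΨ Ψ.finite_toSet
  rw [Set.ncard_coe_finset] at h'
  omega

open Classical in
theorem colorsOn_union_image_subset {V C : Type*} {A : V → V → Prop} {c : V → V → C}
    (hT : IsTournament A) {Z : Finset V} {S : Finset ℕ} {v : ℕ → V} {z : V} {Ψ : Set C}
    (hzS : ∀ i ∈ S, A z (v i)) (hSZ : ∀ i ∈ S, ∀ w ∈ Z, w ≠ z → A (v i) w)
    (hSS : ∀ i ∈ S, ∀ j ∈ S, i < j → A (v i) (v j))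
    (hZ : colorsOn A c Z ⊆ Ψ) (hcz : ∀ i ∈ S, c z (v i) ∈ Ψ)
    (hcZ : ∀ i ∈ S, ∀ w ∈ Z, w ≠ z → c (v i) w ∈ Ψ)
    (hcS : ∀ i ∈ S, ∀ j ∈ S, i < j → c (v i) (v j) ∈ Ψ) :
    colorsOn A c (Z ∪ S.image v) ⊆ Ψ := by
  rintro _ ⟨a, ha, b, hb, hab, rfl⟩
  rcases Finset.mem_union.mp ha with ha | ha <;> rcases Finset.mem_union.mp hb with hb | hb
  · exact hZ ⟨a, ha, b, hb, hab, rfl⟩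
  · obtain ⟨i, hi, rfl⟩ := Finset.mem_image.mp hb
    by_cases haz : a = z
    · subst haz; exact hcz i hi
    · exact absurd hab (hT.asymm (hSZ i hi a ha haz))
  · obtain ⟨i, hi, rfl⟩ := Finset.mem_image.mp ha
    by_cases hbz : b = z
    · subst hbz; exact absurd hab (hT.asymm (hzS i hi))
    · exact hcZ i hi b hb hbz
  · obtain ⟨i, hi, rfl⟩ := Finset.mem_image.mp ha
    obtain ⟨j, hj, rfl⟩ := Finset.mem_image.mp hb
    rcases lt_trichotomy i j with h | rfl | h
    · exact hcS i hi j hj h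
    · exact absurd hab (hT.1 _)
    · exact absurd hab (hT.asymm (hSS j hj i hi h))

open Classical in
/-- There is no transitive sequence `v 0, …, v n` such that no `v (t + 1)` reaches `v t` by a
rainbow path, together with a set `Z` containing `v 0`, from all of whose vertices `v 0` can be
reached inside `Z` using colors in `Φ`, such that `Φ` is small and no rainbow path avoiding `Φ`
and `Z \ {v 0}` joins `v 0` to `v n`. The induction replaces `Z` by its union with an interval of
the sequence. -/
theorem false_of_transitive_sequence {V C : Type*} {A : V → V → Prop} {c : V → V → C}
    (hT : IsTournament A)
    (hcol : ∀ U : Finset V, 3 ≤ U.card → StronglyConnectedOn A U →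
      U.card - 1 ≤ (colorsOn A c U).ncard) {v : ℕ → V} (n : ℕ) (Z : Finset V) (Φ : Finset C)
    (hn : 1 ≤ n) (hv : ∀ i j, i < j → j ≤ n → A (v i) (v j))
    (hvZ : ∀ i, 1 ≤ i → i ≤ n → v i ∉ Z) (hZ : 2 ≤ Z.card) (hΦ : Φ.card + 1 ≤ Z.card)
    (hZΦ : colorsOn A c Z ⊆ Φ)
    (hSZ : ∀ i, 1 ≤ i → i ≤ n → ∀ w ∈ Z, w ≠ v 0 → A (v i) w)
    (hreach : ∀ w ∈ Z, RainbowPathIn A c Z Φ w (v 0))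
    (hback : ∀ t < n, ¬ RainbowReach A c (v (t + 1)) (v t))
    (hlast : ¬ RainbowPathIn A c (↑(Z.erase (v 0)))ᶜ (↑Φ)ᶜ (v 0) (v n)) : False := by
  induction n using Nat.strong_induction_on generalizing Z Φ with
  | _ n ih =>
  set f : ℕ → C := fun t => c (v 0) (v t) with hf
  have hne : ∀ i j, i < j → j ≤ n → v i ≠ v j := fun i j hij hj e =>
    hT.1 (v j) (e ▸ hv i j hij hj)
  have hne' : ∀ i j, i < j → j ≤ n → v j ≠ v i := fun i j hij hj => (hne i j hij hj).symm
  have himage : ∀ a b, b ≤ n → ((Finset.Icc a b).image v).card = b + 1 - a := by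
    intro a b hbn
    rw [Finset.card_image_of_injOn, Nat.card_Icc]
    intro i hi j hj hij
    simp only [Finset.coe_Icc, Set.mem_Icc] at hi hj
    rcases lt_trichotomy i j with h | h | h
    · exact absurd hij (hne i j h (by omega))
    · exact h
    · exact absurd hij (hne' j i h (by omega))
  have hdisj : ∀ a b, 1 ≤ a → b ≤ n → Disjoint Z ((Finset.Icc a b).image v) := by
    intro a b ha hbn
    refine Finset.disjoint_left.mpr fun w hw hs => ?_
    obtain ⟨i, hi, rfl⟩ := Finset.mem_image.mp hs
    rw [Finset.mem_Icc] at hi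
    exact hvZ i (by omega) (by omega) hw
  have hcount : ∀ a b, 1 ≤ a → a ≤ b → b ≤ n → ∀ Ψ : Finset C, Φ ⊆ Ψ →
      (∀ i, a ≤ i → i ≤ b → f i ∈ Ψ) →
      (∀ i, a ≤ i → i ≤ b → ∀ w ∈ Z, w ≠ v 0 → c (v i) w ∈ Ψ) →
      (∀ i j, a ≤ i → i < j → j ≤ b → c (v i) (v j) ∈ Ψ) →
      Z.card + (b + 1 - a) ≤ Ψ.card + 1 := by
    intro a b ha hab hbn Ψ hΦΨ h₁ h₂ h₃
    rw [← himage a b hbn]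
    have memS : ∀ s ∈ (Finset.Icc a b).image v, ∃ i, a ≤ i ∧ i ≤ b ∧ v i = s := fun s hs => by
      obtain ⟨i, hi, rfl⟩ := Finset.mem_image.mp hs
      rw [Finset.mem_Icc] at hi
      exact ⟨i, hi.1, hi.2, rfl⟩
    refine card_add_card_le_of_colors_subset hcol (z := v 0) hZ (hdisj a b ha hbn) ?_ hreach
      ?_ ?_ ?_
    · exact ⟨v a, Finset.mem_image_of_mem _ (Finset.mem_Icc.mpr ⟨le_rfl, hab⟩)⟩
    · intro s hs
      obtain ⟨i, hi, hi', rfl⟩ := memS s hs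
      exact hv 0 i (by omega) (by omega)
    · intro s hs
      obtain ⟨i, hi, hi', rfl⟩ := memS s hs
      exact hSZ i (by omega) (by omega)
    · refine colorsOn_union_image_subset hT (z := v 0) ?_ ?_ ?_
        (hZΦ.trans (Finset.coe_subset.mpr hΦΨ)) ?_ ?_ ?_ <;>
        simp only [Finset.mem_Icc, Finset.mem_coe]
      · exact fun i hi => hv 0 i (by omega) (by omega)
      · exact fun i hi => hSZ i (by omega) (by omega)
      · exact fun i hi j hj hij => hv i j hij (by omega)
      · exact fun i hi => h₁ i hi.1 hi.2
      · exact fun i hi => h₂ i hi.1 hi.2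
      · exact fun i hi j hj hij => h₃ i j hi.1 hij hj.2
  -- colors from `v (t + 1)` to `Z`
  have hfirst : ∀ w ∈ Z, w ≠ v 0 → c (v 1) w ∈ Φ := by
    intro w hw hw0
    by_contra hc
    exact hback 0 (by omega) (RainbowPathIn.push (hSZ 1 le_rfl hn w hw hw0) (hreach w hw)
      (by simpa using hvZ 1 le_rfl hn) (by simpa using hc)).rainbowReach
  have hZf : ∀ t w, 1 ≤ t → t < n → w ∈ Z → f t ∉ Φ →
      RainbowPathIn A c (insert (v t) ↑Z) (insert (f t) ↑Φ) w (v t) := fun t w ht htn hw hft =>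
    (hreach w hw).snoc (hv 0 t (by omega) (by omega)) (by simpa using hvZ t ht (by omega))
      (by simpa using hft)
  have hG : ∀ t, 1 ≤ t → t < n → f t ∉ Φ → ∀ w ∈ Z, w ≠ v 0 → c (v (t + 1)) w ∉ Φ →
      c (v (t + 1)) w = f t := by
    intro t ht htn hft w hw hw0 hc
    by_contra hcf
    refine hback t htn (RainbowPathIn.push (hSZ (t + 1) (by omega) (by omega) w hw hw0)
      (hZf t w ht htn hw hft) ?_ ?_).rainbowReach
    · simp [hvZ (t + 1) (by omega) (by omega), hne' t (t + 1) (by omega) (by omega)]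
    · simp [hc, hcf]
  have hfn : f n ∈ Φ := by
    by_contra hc
    refine hlast (.cons (W := {v n}) (K := ∅) (hv 0 n (by omega) le_rfl) (.refl rfl)
      (by simpa using hne 0 n (by omega) le_rfl) (by simp) ?_ ?_)
    · rintro x (rfl | rfl) <;> simp [hvZ n hn le_rfl]
    · rintro x (rfl | h)
      exacts [by simpa using hc, h.elim]
  have hsingle : ∀ i, 1 ≤ i → i ≤ n → f i ∈ Φ → ∃ w ∈ Z, w ≠ v 0 ∧ c (v i) w ∉ Φ := by
    intro i hi hin hfi
    by_contra! h
    have := hcount i i hi le_rfl hin Φ subset_rfl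
      (fun j h₁ h₂ => by obtain rfl : j = i := by omega
                         exact hfi)
      (fun j h₁ h₂ => by obtain rfl : j = i := by omega
                         exact h)
      (fun j k h₁ h₂ h₃ => by omega)
    omega
  -- `y` is the first index with `f y ∈ Φ`
  have hex : ∃ y, 1 ≤ y ∧ y ≤ n ∧ f y ∈ Φ := ⟨n, hn, le_rfl, hfn⟩
  obtain ⟨hy1, hyn, hfy⟩ := Nat.find_spec hex
  have hymin : ∀ t, 1 ≤ t → t < Nat.find hex → f t ∉ Φ := fun t ht hty hft =>
    Nat.find_min hex hty ⟨ht, by omega, hft⟩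
  generalize Nat.find hex = y at hy1 hyn hfy hymin
  have hy2 : 2 ≤ y := by
    by_contra h
    obtain rfl : y = 1 := by omega
    obtain ⟨w, hw, hw0, hc⟩ := hsingle 1 le_rfl hn hfy
    exact hc (hfirst w hw hw0)
  -- `x` is the last index before `y` from which there are no new colors to `Z`
  obtain ⟨x, hx1, hxy, hx, hxmax⟩ : ∃ x, 1 ≤ x ∧ x < y ∧
      (∀ w ∈ Z, w ≠ v 0 → c (v x) w ∈ Φ) ∧
      ∀ t, x < t → t ≤ y → ∃ w ∈ Z, w ≠ v 0 ∧ c (v t) w ∉ Φ := by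
    let P : ℕ → Prop := fun t => 1 ≤ t ∧ ∀ w ∈ Z, w ≠ v 0 → c (v t) w ∈ Φ
    have hP : P (Nat.findGreatest P (y - 1)) :=
      Nat.findGreatest_spec (m := 1) (by omega) ⟨le_rfl, hfirst⟩
    have hle : Nat.findGreatest P (y - 1) ≤ y - 1 := Nat.findGreatest_le _
    refine ⟨_, hP.1, by omega, hP.2, fun t ht hty => ?_⟩
    rcases eq_or_lt_of_le hty with rfl | hty
    · exact hsingle t hy1 hyn hfy
    · have := Nat.findGreatest_is_greatest ht (by omega)
      by_contra! h
      exact this ⟨by omega, h⟩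
  have hw : ∀ t, x ≤ t → t < y → ∃ w ∈ Z, w ≠ v 0 ∧ c (v (t + 1)) w = f t := by
    intro t hxt hty
    obtain ⟨w, hw, hw0, hc⟩ := hxmax (t + 1) (by omega) (by omega)
    exact ⟨w, hw, hw0, hG t (by omega) (by omega) (hymin t (by omega) hty) w hw hw0 hc⟩
  have hGx : ∀ p, p ≤ y → ∀ i, x ≤ i → i ≤ p → ∀ w ∈ Z, w ≠ v 0 →
      c (v i) w ∈ Φ ∨ ∃ t, x ≤ t ∧ t < p ∧ f t = c (v i) w := by
    intro p hpy i hxi hip w hw hw0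
    rcases eq_or_lt_of_le hxi with rfl | hxi
    · exact Or.inl (hx w hw hw0)
    · by_cases hc : c (v i) w ∈ Φ
      · exact Or.inl hc
      · obtain ⟨t, rfl⟩ : ∃ t, i = t + 1 := ⟨i - 1, by omega⟩
        exact Or.inr ⟨t, by omega, by omega,
          (hG t (by omega) (by omega) (hymin t (by omega) (by omega)) w hw hw0 hc).symm⟩
  have key : ∀ p, x ≤ p → p ≤ y → ∀ i j, x ≤ i → i < j → j ≤ p →
      c (v i) (v j) ∈ Φ ∪ (Finset.Icc x p).image f := by
    intro p hxp
    induction p, hxp using Nat.le_induction with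
    | base => intros; omega
    | succ p hxp ihp =>
      intro hpy i j hxi hij hjp
      have ihp := ihp (by omega)
      have hmono : Φ ∪ (Finset.Icc x p).image f ⊆ Φ ∪ (Finset.Icc x (p + 1)).image f :=
        Finset.union_subset_union_right
          (Finset.image_subset_image (Finset.Icc_subset_Icc_right (by omega)))
      have hfmem : ∀ t q, x ≤ t → t ≤ q → f t ∈ Φ ∪ (Finset.Icc x q).image f := fun t q h₁ h₂ =>
        Finset.mem_union_right _ (Finset.mem_image_of_mem f (Finset.mem_Icc.mpr ⟨h₁, h₂⟩))
      have hgmem : ∀ t, x ≤ t → t ≤ p + 1 → ∀ w ∈ Z, w ≠ v 0 →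
          c (v t) w ∈ Φ ∪ (Finset.Icc x p).image f := by
        intro t hxt htp w hw hw0
        rcases hGx (p + 1) hpy t hxt htp w hw hw0 with h | ⟨s, h₁, h₂, h₃⟩
        · exact Finset.mem_union_left _ h
        · exact h₃ ▸ hfmem s p h₁ (by omega)
      have hcardf : ((Finset.Icc x p).image f).card = (Finset.Icc x p).card := by
        refine le_antisymm Finset.card_image_le ?_
        have := hcount x p hx1 hxp (by omega) _ Finset.subset_union_left
          (fun t h₁ h₂ => hfmem t p h₁ h₂) (fun t h₁ h₂ => hgmem t h₁ (by omega)) ihp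
        have h₁ := Finset.card_union_le Φ ((Finset.Icc x p).image f)
        rw [Nat.card_Icc]
        omega
      have hinj : ∀ a b, x ≤ a → a < b → b ≤ p → f a ≠ f b := by
        intro a b hxa hab hbp e
        have := Finset.card_image_iff.mp hcardf
          (Finset.mem_coe.mpr (Finset.mem_Icc.mpr ⟨hxa, by omega⟩))
          (Finset.mem_coe.mpr (Finset.mem_Icc.mpr ⟨by omega, hbp⟩)) e
        omega
      by_cases hjp' : j ≤ p
      · exact hmono (ihp i j hxi hij hjp')
      obtain rfl : j = p + 1 := by omega
      obtain ⟨w, hwZ, hw0, hwp⟩ := hw p hxp (by omega)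
      have hfp := hymin p (by omega) (by omega)
      have hvp := hvZ (p + 1) (by omega) (by omega)
      have hAw := hSZ (p + 1) (by omega) (by omega) w hwZ hw0
      have hAi : ∀ i, i ≤ p → A (v i) (v (p + 1)) := fun i hi => hv i (p + 1) (by omega) (by omega)
      have hinner : ∀ i, x < i → i ≤ p → c (v i) (v (p + 1)) ∈ Φ ∪ (Finset.Icc x p).image f := by
        intro i hxi hip
        by_contra hc
        have hcΦ : c (v i) (v (p + 1)) ∉ Φ := fun h => hc (Finset.mem_union_left _ h)
        have hcf : ∀ t, x ≤ t → t ≤ p → c (v i) (v (p + 1)) ≠ f t := fun t h₁ h₂ e =>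
          hc (e ▸ hfmem t p h₁ h₂)
        obtain ⟨s, rfl⟩ : ∃ s, i = s + 1 := ⟨i - 1, by omega⟩
        refine hback s (by omega) (RainbowPathIn.push (hAi _ hip) (RainbowPathIn.push hAw
          (hZf s w (by omega) (by omega) hwZ (hymin s (by omega) (by omega)))
          ?_ ?_) ?_ ?_).rainbowReach
        · simp [hvp, hne' s (p + 1) (by omega) (by omega)]
        · simp [hwp, hfp, (hinj s p (by omega) (by omega) le_rfl).symm]
        · simp [hvZ (s + 1) (by omega) (by omega), hne (s + 1) (p + 1) (by omega) (by omega),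
            hne' s (s + 1) (by omega) (by omega)]
        · simp [hwp, hcΦ, hcf s (by omega) (by omega), hcf p hxp le_rfl]
      rcases lt_or_eq_of_le hxi with hxi | rfl
      · exact hmono (hinner i hxi (by omega))
      by_contra hc
      have hcΦ : c (v x) (v (p + 1)) ∉ Φ := fun h => hc (Finset.mem_union_left _ h)
      have hcf : ∀ t, x ≤ t → t ≤ p + 1 → c (v x) (v (p + 1)) ≠ f t := fun t h₁ h₂ e =>
        hc (e ▸ hfmem t (p + 1) h₁ h₂)
      have hAi := hAi x hxp
      have hvx := hvZ x hx1 (by omega)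
      -- the path `v x, v (p + 1), w, …, v 0`
      have hpath : RainbowPathIn A c (insert (v x) (insert (v (p + 1)) ↑Z))
          (insert (c (v x) (v (p + 1))) (insert (f p) ↑Φ)) (v x) (v 0) := by
        have h := RainbowPathIn.push hAw (hreach w hwZ) (by simpa using hvp)
          (by simpa [hwp] using hfp)
        rw [hwp] at h
        refine h.push hAi ?_ ?_
        · simp [hvx, hne x (p + 1) hij (by omega)]
        · simp [hcΦ, hcf p hxp (by omega)]
      have hfp1 : f (p + 1) ∈ Φ ∪ (Finset.Icc x p).image f := by
        rcases eq_or_lt_of_le hpy with h | hlt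
        · exact Finset.mem_union_left _ (h ▸ hfy)
        by_contra hnot
        obtain ⟨w', hwZ', hw0', hwp'⟩ := hw (p + 1) (by omega) hlt
        have hfx := hymin x hx1 hxy
        have hfx' : f (p + 1) ≠ f x := fun e => hnot (e ▸ hfmem x p le_rfl hxp)
        refine hback (p + 1) (by omega) (RainbowPathIn.push
          (hSZ (p + 1 + 1) (by omega) (by omega) w' hwZ' hw0')
          ((hZf x w' hx1 (by omega) hwZ' hfx).snoc hAi ?_ ?_) ?_ ?_).rainbowReach
        · simp [hvp, hne' x (p + 1) hij (by omega)]
        · simp [hcΦ, hcf x le_rfl (by omega)]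
        · simp [hvZ (p + 1 + 1) (by omega) (by omega), hne' x (p + 1 + 1) (by omega) (by omega),
            hne' (p + 1) (p + 1 + 1) (by omega) (by omega)]
        · simp [hwp', hymin (p + 1) (by omega) hlt, hfx',
            (hcf (p + 1) (by omega) le_rfl).symm]
      obtain rfl | ⟨m, rfl, hm⟩ : x = 1 ∨ ∃ m, x = m + 1 ∧ 1 ≤ m := by
        rcases eq_or_lt_of_le hx1 with h | h
        · exact Or.inl h.symm
        · exact Or.inr ⟨x - 1, by omega, by omega⟩
      · exact hback 0 (by omega) hpath.rainbowReach
      set Z' := Z ∪ (Finset.Icc (m + 1) (p + 1)).image v with hZ'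
      set Φ' := insert (c (v (m + 1)) (v (p + 1))) (Φ ∪ (Finset.Icc (m + 1) p).image f) with hΦ'
      have hsub : Φ ∪ (Finset.Icc (m + 1) p).image f ⊆ Φ' := Finset.subset_insert _ _
      have hZsub : Z ⊆ Z' := Finset.subset_union_left
      have hΦsub : Φ ⊆ Φ' := Finset.subset_union_left.trans hsub
      have hvmem : ∀ t, m + 1 ≤ t → t ≤ p + 1 → v t ∈ Z' := fun t h₁ h₂ =>
        Finset.mem_union_right _ (Finset.mem_image_of_mem v (Finset.mem_Icc.mpr ⟨h₁, h₂⟩))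
      have hmemZ' : ∀ u ∈ Z', u ∈ Z ∨ ∃ t, m + 1 ≤ t ∧ t ≤ p + 1 ∧ v t = u := by
        intro u hu
        refine (Finset.mem_union.mp hu).imp_right fun hu => ?_
        obtain ⟨t, ht, rfl⟩ := Finset.mem_image.mp hu
        exact ⟨t, (Finset.mem_Icc.mp ht).1, (Finset.mem_Icc.mp ht).2, rfl⟩
      have hpathV : insert (v (m + 1)) (insert (v (p + 1)) (Z : Set V)) ⊆ Z' := by
        rintro u (rfl | rfl | hu)
        exacts [hvmem _ le_rfl (by omega), hvmem _ (by omega) le_rfl, hZsub hu]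
      have hpathC : insert (c (v (m + 1)) (v (p + 1))) (insert (f p) (Φ : Set C)) ⊆ Φ' := by
        rintro u (rfl | rfl | hu)
        exacts [Finset.mem_insert_self _ _, hsub (hfmem p p hxp le_rfl), hΦsub hu]
      have hcardZ' : Z'.card = Z.card + (p + 1 + 1 - (m + 1)) := by
        rw [hZ', Finset.card_union_of_disjoint (hdisj (m + 1) (p + 1) hx1 (by omega)),
          himage (m + 1) (p + 1) (by omega)]
      refine ih m (by omega) Z' Φ' hm (fun a b hab hb => hv a b hab (by omega)) ?_ (by omega) ?_
        ?_ ?_ ?_ (fun t ht => hback t (by omega)) ?_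
      · intro t ht htm h
        rcases hmemZ' _ h with h | ⟨s, h₁, h₂, h₃⟩
        · exact hvZ t ht (by omega) h
        · exact hne t s (by omega) (by omega) h₃.symm
      · have h₁ := Finset.card_insert_le (c (v (m + 1)) (v (p + 1)))
          (Φ ∪ (Finset.Icc (m + 1) p).image f)
        have h₂ := Finset.card_union_le Φ ((Finset.Icc (m + 1) p).image f)
        rw [hcardf, Nat.card_Icc] at h₂
        rw [hcardZ', hΦ']
        omega
      · refine colorsOn_union_image_subset hT (z := v 0) ?_ ?_ ?_
          (hZΦ.trans (Finset.coe_subset.mpr hΦsub)) ?_ ?_ ?_ <;>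
          simp only [Finset.mem_Icc, Finset.mem_coe]
        · exact fun t ht => hv 0 t (by omega) (by omega)
        · exact fun t ht => hSZ t (by omega) (by omega)
        · exact fun a ha b hb hab => hv a b hab (by omega)
        · intro t ht
          rcases eq_or_lt_of_le ht.2 with rfl | htp
          · exact hsub hfp1
          · exact hsub (hfmem t p ht.1 (by omega))
        · exact fun t ht w hw hw0 => hsub (hgmem t ht.1 ht.2 w hw hw0)
        · intro a ha b hb hab
          rcases eq_or_lt_of_le hb.2 with rfl | hbp
          · rcases eq_or_lt_of_le ha.1 with rfl | ha'
            · exact Finset.mem_insert_self _ _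
            · exact hsub (hinner a ha' (by omega))
          · exact hsub (ihp a b ha.1 hab (by omega))
      · intro t ht htm u hu hu0
        rcases hmemZ' u hu with h | ⟨s, h₁, h₂, rfl⟩
        · exact hSZ t ht (by omega) u h hu0
        · exact hv t s (by omega) (by omega)
      · intro u hu
        rcases hmemZ' u hu with h | ⟨s, h₁, h₂, rfl⟩
        · exact (hreach u h).mono hZsub hΦsub
        rcases eq_or_lt_of_le h₁ with rfl | h₁
        · exact hpath.mono hpathV hpathC
        obtain ⟨q, rfl⟩ : ∃ q, s = q + 1 := ⟨s - 1, by omega⟩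
        obtain ⟨w', hwZ', hw0', hwp'⟩ := hw q (by omega) (by omega)
        refine .cons (hSZ (q + 1) (by omega) (by omega) w' hwZ' hw0') (hreach w' hwZ')
          (by simpa using hvZ (q + 1) (by omega) (by omega))
          (by simpa [hwp'] using hymin q (by omega) (by omega)) ?_ ?_
        · rintro u (rfl | hu)
          exacts [hvmem _ (by omega) h₂, hZsub hu]
        · rintro u (rfl | hu)
          exacts [hsub (hwp' ▸ hfmem q p (by omega) (by omega)), hΦsub hu]
      · intro h
        refine hback m (by omega) ((hpath.mono hpathV hpathC).trans h ?_ ?_).rainbowReach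
        · rintro u ⟨hu, hu'⟩
          by_contra hu0
          exact hu' (Finset.mem_coe.mpr (Finset.mem_erase.mpr ⟨hu0, hu⟩))
        · exact disjoint_compl_right
  have := hcount x y hx1 hxy.le hyn (Φ ∪ (Finset.Ico x y).image f) Finset.subset_union_left
    ?_ ?_ ?_
  · have h₁ := Finset.card_union_le Φ ((Finset.Ico x y).image f)
    have h₂ := Finset.card_image_le (s := Finset.Ico x y) (f := f)
    rw [Nat.card_Ico] at h₂
    omega
  · intro i hxi hiy
    rcases eq_or_lt_of_le hiy with rfl | hiy
    · exact Finset.mem_union_left _ hfy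
    · exact Finset.mem_union_right _ (Finset.mem_image_of_mem f (Finset.mem_Ico.mpr ⟨hxi, hiy⟩))
  · intro i hxi hiy w hw hw0
    rcases hGx y le_rfl i hxi hiy w hw hw0 with h | ⟨t, h₁, h₂, h₃⟩
    · exact Finset.mem_union_left _ h
    · exact Finset.mem_union_right _ (Finset.mem_image.mpr ⟨t, Finset.mem_Ico.mpr ⟨h₁, h₂⟩, h₃⟩)
  · intro i j hxi hij hjy
    rcases Finset.mem_union.mp (key y hxy.le le_rfl i j hxi hij hjy) with h | h
    · exact Finset.mem_union_left _ h
    · obtain ⟨t, ht, hft⟩ := Finset.mem_image.mp h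
      rw [Finset.mem_Icc] at ht
      rcases eq_or_lt_of_le ht.2 with rfl | hty
      · exact Finset.mem_union_left _ (hft ▸ hfy)
      · exact Finset.mem_union_right _
          (Finset.mem_image.mpr ⟨t, Finset.mem_Ico.mpr ⟨ht.1, hty⟩, hft⟩)

/-- If every strongly connected `k`-vertex subtournament of an arc-colored
tournament `T` is colored with at least `k - 1` colors (`3 ≤ k ≤ |V(T)|`),
then `T` has a kernel by rainbow paths. -/
theorem rainbow_kernel_of_colors_ge_card_sub_one {V C : Type*} [Fintype V]
    (A : V → V → Prop) (c : V → V → C) (hT : IsTournament A)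
    (hcol : ∀ U : Finset V, 3 ≤ U.card → StronglyConnectedOn A U →
      U.card - 1 ≤ (colorsOn A c U).ncard) :
    ∃ S : Set V, IsRainbowKernel A c S := by
  classical
  rcases isEmpty_or_nonempty V with hV | ⟨⟨r₀⟩⟩
  · exact ⟨∅, by simp, fun v => hV.elim v⟩
  by_contra hno
  have arcReach : ∀ u v, A u v → RainbowReach A c u v := fun u v h =>
    (RainbowPathIn.push (W := {v}) (K := ∅) h (.refl rfl)
      (fun e => hT.1 v (by rw [Set.mem_singleton_iff] at e; exact e ▸ h))
      (Set.notMem_empty _)).rainbowReach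
  have hnext : ∀ r, ∃ s, A r s ∧ ¬ RainbowReach A c s r := by
    intro r
    by_contra! h
    refine hno ⟨{r}, ?_, ?_⟩
    · rintro u rfl v rfl huv
      exact absurd rfl huv
    · intro v hv
      refine ⟨r, rfl, ?_⟩
      by_cases hrv : A r v
      · exact h v hrv
      · exact arcReach v r ((hT.2 v r hv).mpr hrv)
  choose next hA hR using hnext
  let v : ℕ → V := fun i => next^[i] r₀
  have hvs : ∀ i, v (i + 1) = next (v i) := fun i => Function.iterate_succ_apply' next i r₀
  have hvA : ∀ i, A (v i) (v (i + 1)) := fun i => hvs i ▸ hA (v i)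
  have hvR : ∀ i, ¬ RainbowReach A c (v (i + 1)) (v i) := fun i => hvs i ▸ hR (v i)
  have hex : ∃ k i, A (v (i + k)) (v i) := by
    obtain ⟨i, j, hij, h⟩ := Finite.exists_ne_map_eq_of_infinite v
    wlog hlt : i < j generalizing i j
    · exact this j i hij.symm h.symm (by omega)
    refine ⟨j - 1 - i, i, ?_⟩
    have := hvA (j - 1)
    rwa [show j - 1 + 1 = j by omega, ← h, show j - 1 = i + (j - 1 - i) by omega] at this
  obtain ⟨i, hi⟩ := Nat.find_spec hex
  have hmin : ∀ j < Nat.find hex, ∀ a, ¬ A (v (a + j)) (v a) := fun j hj a h =>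
    Nat.find_min hex hj ⟨a, h⟩
  generalize Nat.find hex = k at hi hmin
  have hk : 2 ≤ k := by
    by_contra hk
    obtain rfl | rfl : k = 0 ∨ k = 1 := by omega
    · exact hT.1 _ hi
    · exact hT.asymm hi (hvA i)
  have hfwd : ∀ a j, 0 < j → j < k → A (v a) (v (a + j)) := by
    intro a j hj hjk
    refine (hT.2 _ _ fun e => ?_).mpr (hmin j hjk a)
    have := hvA (a + (j - 1))
    rw [show a + (j - 1) + 1 = a + j by omega, ← e] at this
    exact hmin (j - 1) (by omega) a this
  have hfwd' : ∀ a b, a < b → b - a < k → A (v (i + a)) (v (i + b)) := by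
    intro a b hab hb
    have := hfwd (i + a) (b - a) (by omega) hb
    rwa [show i + a + (b - a) = i + b by omega] at this
  have hki : v (i + k) ≠ v i := fun e => hT.1 (v i) (by rwa [e] at hi)
  have hcard : ({v (i + k), v i} : Finset V).card = 2 := Finset.card_pair hki
  have hik : A (v (i + k)) (v (i + 0)) := hi
  refine false_of_transitive_sequence hT hcol (v := fun t => v (i + t)) (k - 1)
    {v (i + k), v i} {c (v (i + k)) (v i)} (by omega) ?_ ?_ ?_ ?_ ?_ ?_ ?_ ?_ ?_
  · exact fun a b hab hb => hfwd' a b hab (by omega)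
  · intro a ha hak h
    rw [Finset.mem_insert, Finset.mem_singleton] at h
    rcases h with h | h
    · exact hT.1 _ (h ▸ hfwd' a k (by omega) (by omega))
    · exact hT.1 _ (h ▸ hfwd' 0 a (by omega) (by omega))
  · exact hcard.ge
  · simp [hcard]
  · rintro _ ⟨a, ha, b, hb, hab, rfl⟩
    rw [Finset.mem_insert, Finset.mem_singleton] at ha hb
    rcases ha with rfl | rfl <;> rcases hb with rfl | rfl
    · exact absurd hab (hT.1 _)
    · simp
    · exact absurd hab (hT.asymm hi)
    · exact absurd hab (hT.1 _)
  · intro a ha hak w hw hw0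
    rw [Finset.mem_insert, Finset.mem_singleton] at hw
    rcases hw with rfl | rfl
    · exact hfwd' a k (by omega) (by omega)
    · exact absurd rfl hw0
  · intro w hw
    rw [Finset.mem_insert, Finset.mem_singleton] at hw
    rcases hw with rfl | rfl
    · exact .cons (W := {v i}) (K := ∅) hi (.refl rfl) (by simpa using hki) (by simp)
        (by simp) (by simp)
    · exact .refl (by simp)
  · exact fun t _ => hvR (i + t)
  · intro h
    have h' := (RainbowPathIn.push hik h (by simpa using hki) (by simp)).rainbowReach
    have := hvR (i + (k - 1))
    rw [show i + (k - 1) + 1 = i + k by omega] at this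
    exact this h'
end

section
/- For every integer n ≥ 3 there exists an arc-colored tournament T on n vertices such that every strongly connected k-vertex subtournament of T, 3 ≤ k ≤ n, is colored with at least k−2 colors, yet T has no kernel by rainbow paths. (Hence the bound k−1 in the sufficient condition for rainbow kernels in tournaments cannot be lowered to k−2.) -/
/-- Monochromatic rainbow paths have at most one arc. -/
theorem rainbowReach_const_iff {V C : Type*} {A : V → V → Prop} {k : C} {u v : V} (huv : u ≠ v) :
    RainbowReach A (fun _ _ => k) u v ↔ A u v := by
  constructor
  · rintro ⟨l, hu, hv, -, hA, hc⟩
    match l with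
    | [] => simp at hu
    | [x] => simp_all
    | [x, y] =>
      simp only [List.head?_cons, Option.some.injEq, List.getLast?_cons_cons,
        List.getLast?_singleton] at hu hv
      subst hu hv
      exact List.isChain_pair.1 hA
    | x :: y :: z :: t => simp at hc
  · intro h
    exact ⟨[u, v], rfl, rfl, by simpa using huv, List.isChain_pair.2 h, by simp⟩

/-- Rainbow kernels of a monochromatic digraph are kernels. -/
theorem IsRainbowKernel.isKernel_of_const {V C : Type*} {A : V → V → Prop} {k : C} {S : Set V}
    (h : IsRainbowKernel A (fun _ _ => k) S) : IsKernel A S := by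
  refine ⟨fun u hu v hv huv hA => h.1 u hu v hv huv ((rainbowReach_const_iff huv).2 hA),
    fun v hv => ?_⟩
  obtain ⟨s, hs, hr⟩ := h.2 v hv
  exact ⟨s, hs, (rainbowReach_const_iff (by rintro rfl; exact hv hs)).1 hr⟩

/-- The tournament on `Fin n` in which `0 → 1 → 2 → 0` and all other arcs go from the larger
to the smaller vertex. -/
def sinkTriangle (n : ℕ) (a b : Fin n) : Prop :=
  (3 ≤ a.val ∧ b.val < a.val) ∨ (a.val < 3 ∧ b.val = (a.val + 1) % 3)

theorem isTournament_sinkTriangle (n : ℕ) : IsTournament (sinkTriangle n) := by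
  refine ⟨fun v => ?_, fun u v huv => ?_⟩
  · unfold sinkTriangle
    omega
  · have := Fin.val_ne_of_ne huv
    unfold sinkTriangle
    omega

/-- A strongly connected subtournament of `sinkTriangle n` with at least two vertices lies in
the triangle. -/
theorem StronglyConnectedOn.val_lt_three_of_sinkTriangle {n : ℕ} {U : Finset (Fin n)}
    (hU : 1 < U.card) (h : StronglyConnectedOn (sinkTriangle n) U) {v : Fin n} (hv : v ∈ U) :
    v.val < 3 := by
  obtain ⟨m, hm, hmax⟩ := U.exists_max_image id ⟨v, hv⟩
  have hvm : v.val ≤ m.val := hmax v hv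
  obtain ⟨a, ha, ham⟩ := Finset.exists_mem_ne hU m
  rcases (h a ha m hm).cases_tail with rfl | ⟨p, -, hp, -, hpm⟩
  · exact absurd rfl ham
  · have hpm' : p.val ≤ m.val := hmax p hp
    unfold sinkTriangle at hpm
    omega

theorem not_isKernel_sinkTriangle {n : ℕ} (hn : 3 ≤ n) (S : Set (Fin n)) :
    ¬ IsKernel (sinkTriangle n) S := by
  rintro ⟨hind, habs⟩
  have not_mem : ∀ x y z : Fin n, x.val < 3 → y.val = (x.val + 1) % 3 →
      z.val = (y.val + 1) % 3 → x ∉ S := by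
    intro x y z hx hy hz hxS
    have hyS : y ∉ S := fun hyS => hind x hxS y hyS
      (by rintro rfl; omega) (Or.inr ⟨hx, hy⟩)
    have hzS : z ∉ S := fun hzS => hind z hzS x hxS
      (by rintro rfl; omega) (Or.inr ⟨by omega, by omega⟩)
    obtain ⟨s, hs, hys⟩ := habs y hyS
    have : s = z := by
      unfold sinkTriangle at hys
      exact Fin.ext (by omega)
    exact hzS (this ▸ hs)
  have not_mem_of_lt : ∀ x : Fin n, x.val < 3 → x ∉ S := fun x hx =>
    not_mem x ⟨(x.val + 1) % 3, by omega⟩ ⟨((x.val + 1) % 3 + 1) % 3, by omega⟩ hx rfl rfl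
  obtain ⟨s, hs, h0s⟩ := habs ⟨0, by omega⟩ (not_mem_of_lt _ (by simp))
  refine not_mem_of_lt s ?_ hs
  simp only [sinkTriangle] at h0s
  omega

/-- For every `n ≥ 3` there is an arc-colored tournament on `n` vertices in which
every strongly connected `k`-vertex subtournament (`3 ≤ k ≤ n`) is colored with at
least `k - 2` colors, yet the tournament has no kernel by rainbow paths. -/
theorem exists_tournament_colors_card_sub_two_no_rainbow_kernel (n : ℕ) (hn : 3 ≤ n) :
    ∃ (A : Fin n → Fin n → Prop) (c : Fin n → Fin n → ℕ),
      IsTournament A ∧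
      (∀ U : Finset (Fin n), 3 ≤ U.card → StronglyConnectedOn A U →
        U.card - 2 ≤ (colorsOn A c U).ncard) ∧
      ¬ ∃ S : Set (Fin n), IsRainbowKernel A c S := by
  refine ⟨sinkTriangle n, fun _ _ => 0, isTournament_sinkTriangle n, fun U hU hconn => ?_,
    fun ⟨S, hS⟩ => not_isKernel_sinkTriangle hn S hS.isKernel_of_const⟩
  have hcard : U.card ≤ 3 := by
    simpa using Finset.card_le_card_of_injOn (t := Finset.range 3) Fin.val
      (fun v hv => by
        simpa using hconn.val_lt_three_of_sinkTriangle (by omega) hv)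
      Fin.val_injective.injOn
  obtain ⟨a, ha, b, hb, hab⟩ := Finset.one_lt_card.1 (by omega : 1 < U.card)
  have hcolors : colorsOn (sinkTriangle n) (fun _ _ => 0) U = {0} := by
    ext x
    constructor
    · rintro ⟨-, -, -, -, -, rfl⟩
      rfl
    · rintro rfl
      by_cases h : sinkTriangle n a b
      · exact ⟨a, ha, b, hb, h, rfl⟩
      · exact ⟨b, hb, a, ha, ((isTournament_sinkTriangle n).2 b a hab.symm).2 h, rfl⟩
  rw [hcolors, Set.ncard_singleton]
  omega
end

section
/- There exists a tournament on 5 vertices together with an arc-coloring using exactly 2 colors such that the colored tournament contains no monochromatic directed triangle and has no kernel by rainbow paths. (Concretely: vertices v1,…,v5 with arcs v1→v2→v3→v4→v5→v1 all of one color and arcs v1→v3, v3→v5, v5→v2, v2→v4, v4→v1 all of a second color.) -/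
/-- The circulant tournament on `ℤ/5` with arcs `u → u + 1` and `u → u + 2`. -/
def circArc (u v : Fin 5) : Prop := v = u + 1 ∨ v = u + 2

instance (u v : Fin 5) : Decidable (circArc u v) :=
  inferInstanceAs (Decidable (_ ∨ _))

/-- Arcs `u → u + 1` get color `0`, arcs `u → u + 2` get color `1`. -/
def circColor (u v : Fin 5) : Fin 2 := if v = u + 1 then 0 else 1

theorem rainbowReach_circ_of_arc {u v : Fin 5} (h : circArc u v) :
    RainbowReach circArc circColor u v := by
  have hne : u ≠ v := by revert u v; decide
  exact ⟨[u, v], by simp, by simp, by simpa using hne, List.isChain_pair.2 h, by simp⟩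

/-- Two colors allow at most two arcs on a rainbow path, so no vertex reaches its predecessor. -/
theorem not_rainbowReach_circ_pred (s : Fin 5) :
    ¬ RainbowReach circArc circColor (s + 1) s := by
  rintro ⟨l, hhead, hlast, -, hchain, hcolors⟩
  replace hchain : l.IsChain circArc := hchain
  have hlen := hcolors.length_le_card
  match l with
  | [] => simp at hhead
  | [a] =>
    simp only [List.head?_cons, List.getLast?_singleton, Option.some.injEq] at hhead hlast
    subst hhead
    clear hchain hcolors hlen
    revert hlast
    decide +revert
  | [a, b] =>
    simp at hhead hlast hchain
    subst hhead hlast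
    revert hchain
    clear hcolors hlen
    decide +revert
  | [a, b, d] =>
    simp at hhead hlast hchain hcolors
    subst hhead hlast
    revert hchain hcolors
    clear hlen
    decide +revert
  | a :: b :: d :: e :: t => simp at hlen

theorem not_isRainbowKernel_circ (S : Set (Fin 5)) :
    ¬ IsRainbowKernel circArc circColor S := by
  rintro ⟨hind, habs⟩
  have hsub : ∀ u ∈ S, ∀ v ∈ S, u = v := by
    intro u hu v hv
    by_contra hne
    have h : circArc u v ∨ circArc v u := by
      clear hu hv; decide +revert
    rcases h with h | h
    · exact hind u hu v hv hne (rainbowReach_circ_of_arc h)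
    · exact hind v hv u hu (Ne.symm hne) (rainbowReach_circ_of_arc h)
  obtain ⟨s, hs⟩ : S.Nonempty := by
    by_contra hS
    obtain ⟨s, hs, -⟩ := habs 0 fun h => hS ⟨0, h⟩
    exact hS ⟨s, hs⟩
  have hnot : s + 1 ∉ S := fun h => by
    have heq := hsub _ h _ hs
    clear hs h
    revert heq
    decide +revert
  obtain ⟨t, ht, hreach⟩ := habs _ hnot
  rw [hsub t ht s hs] at hreach
  exact not_rainbowReach_circ_pred s hreach

theorem colorsOn_circ : colorsOn circArc circColor Finset.univ = Set.univ := by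
  ext x
  simp only [colorsOn, Finset.mem_univ, true_and, Set.mem_ofPred_eq, Set.mem_univ, iff_true]
  decide +revert

/-- There is a tournament on 5 vertices with an arc-coloring using exactly 2 colors,
with no monochromatic directed triangle and no kernel by rainbow paths. -/
theorem exists_two_colored_T5_no_rainbow_kernel :
    ∃ (A : Fin 5 → Fin 5 → Prop) (c : Fin 5 → Fin 5 → Fin 2),
      IsTournament A ∧
      (colorsOn A c Finset.univ).ncard = 2 ∧
      (∀ a b d : Fin 5, A a b → A b d → A d a →
        ¬ (c a b = c b d ∧ c b d = c d a)) ∧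
      ¬ ∃ S : Set (Fin 5), IsRainbowKernel A c S := by
  refine ⟨circArc, circColor, ⟨by decide, by decide⟩, ?_, by decide, ?_⟩
  · rw [colorsOn_circ, Set.ncard_univ, Nat.card_fin]
  · rintro ⟨S, hS⟩
    exact not_isRainbowKernel_circ S hS
end

section
/- Every arc-colored tournament in which every directed triangle is rainbow (i.e., the three arcs of every directed 3-cycle receive three pairwise distinct colors) has a kernel by rainbow paths. -/
theorem rainbowReach_of_arc {V C : Type*} {A : V → V → Prop} (c : V → V → C) {u v : V}
    (hne : u ≠ v) (huv : A u v) : RainbowReach A c u v :=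
  ⟨[u, v], by simp [IsRainbowPath, List.Chain', hne, huv]⟩

theorem rainbowReach_of_two_arcs {V C : Type*} {A : V → V → Prop} (c : V → V → C) {u w v : V}
    (huw : u ≠ w) (hwv : w ≠ v) (huv : u ≠ v) (h₁ : A u w) (h₂ : A w v)
    (hc : c u w ≠ c w v) : RainbowReach A c u v :=
  ⟨[u, w, v], by simp [IsRainbowPath, List.Chain', huw, hwv, huv, h₁, h₂, hc]⟩

/-- If every directed triangle is rainbow, then every vertex reaches each vertex of maximum
in-degree by a rainbow path of length at most two. -/
theorem rainbowReach_of_inDegree_max {V C : Type*} [Fintype V]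
    {A : V → V → Prop} {c : V → V → C} (hT : IsTournament A)
    (htri : ∀ a b d : V, A a b → A b d → A d a →
      c a b ≠ c b d ∧ c b d ≠ c d a ∧ c a b ≠ c d a)
    {s v : V} (hs : {d | A d v}.ncard ≤ {d | A d s}.ncard) (hvs : v ≠ s) :
    RainbowReach A c v s := by
  by_contra hreach
  have hnvs : ¬ A v s := fun h => hreach (rainbowReach_of_arc c hvs h)
  have hsv : A s v := (hT.2 s v hvs.symm).2 hnvs
  refine absurd hs (not_le.2 (Set.ncard_lt_ncard ⟨fun d hds => ?_, fun h => hT.1 s (h hsv)⟩))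
  have hds : A d s := hds
  have hdv : d ≠ v := by rintro rfl; exact hnvs hds
  have hds' : d ≠ s := by rintro rfl; exact hT.1 d hds
  refine (hT.2 d v hdv).2 fun hvd => hreach ?_
  exact rainbowReach_of_two_arcs c hdv.symm hds' hvs hvd hds (htri s v d hsv hvd hds).2.1

/-- Every arc-colored tournament in which every directed triangle is rainbow has a
kernel by rainbow paths. -/
theorem rainbow_kernel_of_rainbow_triangles {V C : Type*} [Fintype V]
    (A : V → V → Prop) (c : V → V → C) (hT : IsTournament A)
    (htri : ∀ a b d : V, A a b → A b d → A d a →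
      c a b ≠ c b d ∧ c b d ≠ c d a ∧ c a b ≠ c d a) :
    ∃ S : Set V, IsRainbowKernel A c S := by
  cases isEmpty_or_nonempty V with
  | inl h => exact ⟨∅, fun u => isEmptyElim u, fun v => isEmptyElim v⟩
  | inr h =>
    obtain ⟨s, hs⟩ := Finite.exists_max fun v : V => {d | A d v}.ncard
    refine ⟨{s}, ?_, fun v hv => ⟨s, rfl, rainbowReach_of_inDegree_max hT htri (hs v) hv⟩⟩
    rintro u rfl v rfl h
    exact absurd rfl h
end

section
/- Let T be an arc-colored tournament. If every strongly connected k-vertex subtournament of T is colored with at least k colors, for every k with 3 ≤ k ≤ |V(T)|, then T has a kernel by rainbow paths. -/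
/-- An arc is a rainbow path. -/
theorem RainbowReach.of_arc {V C : Type*} {A : V → V → Prop} {c : V → V → C} {u v : V}
    (huv : u ≠ v) (h : A u v) : RainbowReach A c u v :=
  ⟨[u, v], by simp, by simp, by simpa using huv, List.isChain_pair.2 h, by simp⟩

/-- Two consecutive arcs with different colors and distinct endpoints form a rainbow path. -/
theorem RainbowReach.of_arc_arc {V C : Type*} {A : V → V → Prop} {c : V → V → C} {u x v : V}
    (hux : u ≠ x) (huv : u ≠ v) (hxv : x ≠ v) (h₁ : A u x) (h₂ : A x v)
    (hc : c u x ≠ c x v) : RainbowReach A c u v :=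
  ⟨[u, x, v], by simp, by simp, by simp [hux, huv, hxv],
    List.isChain_cons_cons.2 ⟨h₁, List.isChain_pair.2 h₂⟩, by simpa using hc⟩

/-- The vertex set of a directed triangle is strongly connected. -/
theorem StronglyConnectedOn.of_triangle {V : Type*} [DecidableEq V] {A : V → V → Prop} {a b d : V}
    (hab : A a b) (hbd : A b d) (hda : A d a) : StronglyConnectedOn A {a, b, d} := by
  let R := Relation.ReflTransGen
    fun p q => p ∈ ({a, b, d} : Finset V) ∧ q ∈ ({a, b, d} : Finset V) ∧ A p q
  have h₁ : R a b := .single ⟨by simp, by simp, hab⟩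
  have h₂ : R b d := .single ⟨by simp, by simp, hbd⟩
  have h₃ : R d a := .single ⟨by simp, by simp, hda⟩
  intro p hp q hq
  simp only [Finset.mem_insert, Finset.mem_singleton] at hp hq
  rcases hp with rfl | rfl | rfl <;> rcases hq with rfl | rfl | rfl <;>
    first
    | exact .refl
    | assumption
    | exact h₁.trans h₂
    | exact h₂.trans h₃
    | exact h₃.trans h₁

/-- In a tournament, at most the three colors of its arcs occur on a directed triangle. -/
theorem colorsOn_triangle_subset {V C : Type*} [DecidableEq V] {A : V → V → Prop}
    {c : V → V → C} (hT : IsTournament A) {a b d : V}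
    (hab : A a b) (hbd : A b d) (hda : A d a) :
    colorsOn A c {a, b, d} ⊆ {c a b, c b d, c d a} := by
  have asymm : ∀ {p q}, A p q → ¬ A q p := fun {p q} h =>
    (hT.2 p q fun e => hT.1 q (e ▸ h)).1 h
  rintro _ ⟨p, hp, q, hq, hpq, rfl⟩
  simp only [Finset.mem_insert, Finset.mem_singleton] at hp hq
  rcases hp with rfl | rfl | rfl <;> rcases hq with rfl | rfl | rfl <;>
    first
    | exact absurd hpq (hT.1 _)
    | exact absurd hpq (asymm ‹_›)
    | simp

/-- If every strongly connected `k`-vertex subtournament of an arc-colored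
tournament `T` is colored with at least `k` colors (`3 ≤ k ≤ |V(T)|`), then `T`
has a kernel by rainbow paths. -/
theorem rainbow_kernel_of_colors_ge_card {V C : Type*} [Fintype V]
    (A : V → V → Prop) (c : V → V → C) (hT : IsTournament A)
    (hcol : ∀ U : Finset V, 3 ≤ U.card → StronglyConnectedOn A U →
      U.card ≤ (colorsOn A c U).ncard) :
    ∃ S : Set V, IsRainbowKernel A c S := by
  classical
  have ne : ∀ {p q}, A p q → p ≠ q := fun {p q} h e => hT.1 q (e ▸ h)
  rcases isEmpty_or_nonempty V with _ | _
  · exact ⟨∅, by simp, fun v => isEmptyElim v⟩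
  -- Vertices that do not reach a vertex of minimum out-degree would have smaller out-degree.
  obtain ⟨v, hv⟩ := Finite.exists_min fun v => (Finset.univ.filter (A v)).card
  refine ⟨{v}, by rintro _ rfl _ rfl h; exact absurd rfl h, fun u hu => ⟨v, rfl, ?_⟩⟩
  have huv : u ≠ v := hu
  by_cases hA : A u v
  · exact .of_arc huv hA
  have hvu : A v u := (hT.2 v u huv.symm).2 hA
  obtain ⟨x, hux, hxv⟩ : ∃ x, A u x ∧ A x v := by
    by_contra! h
    refine (Finset.card_lt_card ?_).not_ge (hv u)
    rw [Finset.ssubset_iff_of_subset]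
    · exact ⟨u, by simpa using hvu, by simpa using hT.1 u⟩
    · intro x hx
      simp only [Finset.mem_filter, Finset.mem_univ, true_and] at hx ⊢
      exact (hT.2 v x fun e => hA (e ▸ hx)).2 (h x hx)
  refine .of_arc_arc (ne hux) huv (ne hxv) hux hxv fun hc => ?_
  have hcard : ({v, u, x} : Finset V).card = 3 :=
    Finset.card_eq_three.2 ⟨v, u, x, huv.symm, (ne hxv).symm, ne hux, rfl⟩
  have h := hcol {v, u, x} hcard.ge (.of_triangle hvu hux hxv)
  have hsub := colorsOn_triangle_subset (c := c) hT hvu hux hxv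
  rw [hc, Set.pair_eq_singleton] at hsub
  have := (Set.ncard_le_ncard hsub (Set.toFinite _)).trans (Set.ncard_insert_le _ _)
  rw [Set.ncard_singleton] at this
  omega
end

section
/- Let T be an arc-colored tournament on n ≥ 3 vertices with a Hamilton cycle (v_0, v_1, …, v_{n−1}, v_0) such that every directed triangle of T is colored with at least 2 colors and, for every i with 0 ≤ i ≤ n−1, there is no rainbow path from v_i to v_{i−1} in T (indices modulo n). Then v_i → v_{i+2} for every i with 0 ≤ i ≤ n−1 (indices modulo n). -/
/-- If `a → b → d` with distinct vertices and there is no rainbow path from `a` to `d`,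
then the two arcs have the same color. -/
theorem color_eq_of_not_rainbowReach {V C : Type*} {A : V → V → Prop} {c : V → V → C}
    {a b d : V} (hab : A a b) (hbd : A b d) (nab : a ≠ b) (nbd : b ≠ d) (nad : a ≠ d)
    (h : ¬ RainbowReach A c a d) : c a b = c b d := by
  by_contra hc
  refine h ⟨[a, b, d], rfl, rfl, ?_, ?_, ?_⟩
  · simp [nab, nbd, nad]
  · exact List.IsChain.cons_cons hab (List.IsChain.cons_cons hbd (List.IsChain.singleton d))
  · simpa using hc

/-- Let `T` be an arc-colored tournament on `n ≥ 3` vertices with a Hamilton cycle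
`(v_0, v_1, …, v_{n-1}, v_0)` such that every directed triangle is colored with at
least 2 colors and there is no rainbow path from `v_i` to `v_{i-1}` for any `i`
(indices modulo `n`). Then `v_i → v_{i+2}` for every `i` (indices modulo `n`). -/
theorem arc_to_second_successor_on_hamilton_cycle {V C : Type*} [Fintype V]
    (A : V → V → Prop) (c : V → V → C) (hT : IsTournament A)
    (n : ℕ) (hn : 3 ≤ n) (v : ZMod n → V) (hbij : Function.Bijective v)
    (hham : ∀ i : ZMod n, A (v i) (v (i + 1)))
    (htri : ∀ a b d : V, A a b → A b d → A d a →
      ¬ (c a b = c b d ∧ c b d = c d a))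
    (hnp : ∀ i : ZMod n, ¬ RainbowReach A c (v i) (v (i - 1))) :
    ∀ i : ZMod n, A (v i) (v (i + 2)) := by
  intro i
  have h2 : (2 : ZMod n) ≠ 0 := by
    intro h
    have h' : ((2 : ℕ) : ZMod n) = 0 := by exact_mod_cast h
    have := Nat.le_of_dvd (by norm_num) ((ZMod.natCast_eq_zero_iff 2 n).1 h')
    omega
  have n02 : v i ≠ v (i + 2) := fun h => h2 (by simpa using hbij.1 h)
  have h01 : A (v i) (v (i + 1)) := hham i
  have h12 : A (v (i + 1)) (v (i + 2)) := by
    have := hham (i + 1)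
    rwa [add_assoc, one_add_one_eq_two] at this
  have ne_of_arc : ∀ {a b : V}, A a b → a ≠ b := fun h e => hT.1 _ (e ▸ h)
  by_contra hn02
  have h20 : A (v (i + 2)) (v i) := (hT.2 _ _ n02.symm).2 hn02
  have p1 : ¬ RainbowReach A c (v (i + 1)) (v i) := by
    simpa using hnp (i + 1)
  have p2 : ¬ RainbowReach A c (v (i + 2)) (v (i + 1)) := by
    have := hnp (i + 2)
    rwa [show i + 2 - 1 = i + 1 by ring] at this
  have e1 := color_eq_of_not_rainbowReach h12 h20 (ne_of_arc h12) n02.symm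
    (ne_of_arc h01).symm p1
  have e2 := color_eq_of_not_rainbowReach h20 h01 n02.symm (ne_of_arc h01)
    (ne_of_arc h12).symm p2
  exact htri _ _ _ h01 h12 h20 ⟨(e1.trans e2).symm, e1⟩
end
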